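/- Let ρ ≥ 1 be an integer and γ a real number with 2(ρ − 1)π < γ < 2ρπ. Then there exists a unique τ ∈ (0, π) satisfying the transcendental equation (2τ + 2(ρ − 1)π − γ)/(2ρ − 1) = 2·arctan(sin τ/(2ρ − cos τ)). -/

import Mathlib

open Real

/-- The derivative of `τ ↦ arctan (sin τ / (a - cos τ))` for `1 < a`. -/
theorem hasDerivAt_arctan_sin_div_sub_cos {a : ℝ} (ha : 1 < a) (x : ℝ) :
    HasDerivAt (fun τ => arctan (sin τ / (a - cos τ)))
      ((a * cos x - 1) / (a ^ 2 - 2 * a * cos x + 1)) x := by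
  have hc := cos_le_one x
  have hd : a - cos x ≠ 0 := by linarith
  have hD : a ^ 2 - 2 * a * cos x + 1 ≠ 0 := by nlinarith
  have h := (((hasDerivAt_sin x).div ((hasDerivAt_cos x).const_sub a) hd)).arctan
  refine h.congr_deriv ?_
  have hs : (a - cos x) ^ 2 + sin x ^ 2 = a ^ 2 - 2 * a * cos x + 1 := by
    linear_combination sin_sq_add_cos_sq x
  have h1 : 1 + (sin x / (a - cos x)) ^ 2
      = (a ^ 2 - 2 * a * cos x + 1) / (a - cos x) ^ 2 := by
    rw [← hs]
    field_simp
  simp only [Pi.div_apply]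
  rw [h1]
  generalize a ^ 2 - 2 * a * cos x + 1 = D at hD ⊢
  field_simp
  linear_combination -1 * sin_sq_add_cos_sq x

/-- For `1 < a` the function `τ ↦ τ / (a - 1) - arctan (sin τ / (a - cos τ))` is strictly
increasing on `[0, π]`. -/
theorem strictMonoOn_div_sub_arctan {a : ℝ} (ha : 1 < a) :
    StrictMonoOn (fun τ => τ / (a - 1) - arctan (sin τ / (a - cos τ))) (Set.Icc 0 π) := by
  have hder (x : ℝ) := ((hasDerivAt_id' x).div_const (a - 1)).sub
    (hasDerivAt_arctan_sin_div_sub_cos ha x)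
  refine strictMonoOn_of_deriv_pos (convex_Icc 0 π)
    (fun x _ => (hder x).continuousAt.continuousWithinAt) fun x hx => ?_
  rw [interior_Icc] at hx
  have hc : cos x < 1 := by
    simpa using cos_lt_cos_of_nonneg_of_le_pi le_rfl hx.2.le hx.1
  refine (sub_pos.2 ?_).trans_eq (hder x).deriv.symm
  rw [div_lt_div_iff₀ (by nlinarith) (by linarith)]
  nlinarith [mul_pos (show 0 < a * (a + 1) by positivity) (sub_pos.2 hc)]

/-- For `2(ρ−1)π < γ < 2ρπ` the transcendental equation
`(2τ + 2(ρ−1)π − γ)/(2ρ−1) = 2 arctan(sin τ/(2ρ − cos τ))` has a unique solution `τ ∈ (0, π)`. -/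
theorem transcendental_equation_unique_solution
    (ρ : ℕ) (hρ : 1 ≤ ρ) (γ : ℝ)
    (hγ₁ : 2 * ((ρ : ℝ) - 1) * π < γ) (hγ₂ : γ < 2 * (ρ : ℝ) * π) :
    ∃! τ : ℝ, τ ∈ Set.Ioo (0 : ℝ) π ∧
      (2 * τ + 2 * ((ρ : ℝ) - 1) * π - γ) / (2 * (ρ : ℝ) - 1)
        = 2 * Real.arctan (Real.sin τ / (2 * (ρ : ℝ) - Real.cos τ)) := by
  have hρ' : (1 : ℝ) ≤ ρ := by exact_mod_cast hρ
  have ha : (1 : ℝ) < 2 * ρ := by linarith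
  have ha' : (0 : ℝ) < 2 * ρ - 1 := by linarith
  set f : ℝ → ℝ := fun τ => τ / (2 * ρ - 1) - arctan (sin τ / (2 * ρ - cos τ)) with hf
  have hmono : StrictMonoOn f (Set.Icc 0 π) := strictMonoOn_div_sub_arctan ha
  have hcont : ContinuousOn f (Set.Icc 0 π) := fun x _ =>
    ((continuous_id.div_const _).continuousAt.sub
      (hasDerivAt_arctan_sin_div_sub_cos ha x).continuousAt).continuousWithinAt
  have key (τ : ℝ) : (2 * τ + 2 * ((ρ : ℝ) - 1) * π - γ) / (2 * (ρ : ℝ) - 1)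
      = 2 * arctan (sin τ / (2 * (ρ : ℝ) - cos τ)) ↔
      f τ = (γ - 2 * ((ρ : ℝ) - 1) * π) / 2 / (2 * ρ - 1) := by
    have h : (2 * τ + 2 * ((ρ : ℝ) - 1) * π - γ) / (2 * (ρ : ℝ) - 1)
        = 2 * (τ / (2 * ρ - 1)) - 2 * ((γ - 2 * ((ρ : ℝ) - 1) * π) / 2 / (2 * ρ - 1)) := by
      ring
    rw [h, hf]
    constructor <;> intro h' <;> linarith
  simp only [key]
  have hmem : (γ - 2 * ((ρ : ℝ) - 1) * π) / 2 / (2 * ρ - 1) ∈ Set.Ioo (f 0) (f π) := by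
    have h0 : f 0 = 0 := by simp [hf]
    have hπ : f π = π / (2 * ρ - 1) := by simp [hf]
    rw [h0, hπ]
    exact ⟨div_pos (by linarith) ha', div_lt_div_of_pos_right (by linarith) ha'⟩
  obtain ⟨τ, hτ, hfτ⟩ := intermediate_value_Ioo pi_pos.le hcont hmem
  exact ⟨τ, ⟨hτ, hfτ⟩, fun σ hσ => hmono.injOn (Set.Ioo_subset_Icc_self hσ.1)
    (Set.Ioo_subset_Icc_self hτ) (hσ.2.trans hfτ.symm)⟩
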